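/- arXiv:2302.07125 — 2 statements merged into one kernel-verified Lean document; each statement's English description precedes it below -/
import Mathlib

section
/- For all probability measures μ, ν on ℝ^d with finite second moments, every x ∈ ℝ^d, and every probability measure χ on ℝ^d × ℝ^d whose first marginal is μ and whose second marginal is ν, one has ( ∫_Θ |G(μ,x,θ) − G(ν,x,θ)|² ϑ(dθ) )^{1/2} ≤ 2 ( ∫_Θ C(θ)⁴ ϑ(dθ) )^{1/2} ( ∫_{ℝ^d×ℝ^d} |a−b|² χ(da,db) )^{1/2}. -/
open MeasureTheory
open scoped RealInnerProductSpace BigOperators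

/-- The fluctuation field
`G(ν,x,θ) = (D_xΨ(x,θ))ᵀ(f(θ) − ∫Ψ(y,θ)ν(dy)) − ∫_Θ (D_xΨ(x,θ'))ᵀ(f(θ') − ∫Ψ(y,θ')ν(dy)) ϑ(dθ')`. -/
noncomputable def Gfield {Θ : Type*} [MeasurableSpace Θ] {d k₀ : ℕ} (ϑ : Measure Θ)
    (f : Θ → EuclideanSpace ℝ (Fin k₀))
    (Ψ : EuclideanSpace ℝ (Fin d) → Θ → EuclideanSpace ℝ (Fin k₀))
    (DΨ : EuclideanSpace ℝ (Fin d) → Θ →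
      (EuclideanSpace ℝ (Fin d) →L[ℝ] EuclideanSpace ℝ (Fin k₀)))
    (ν : Measure (EuclideanSpace ℝ (Fin d)))
    (x : EuclideanSpace ℝ (Fin d)) (θ : Θ) : EuclideanSpace ℝ (Fin d) :=
  ContinuousLinearMap.adjoint (DΨ x θ) (f θ - ∫ y, Ψ y θ ∂ν)
    - ∫ θ', ContinuousLinearMap.adjoint (DΨ x θ') (f θ' - ∫ y, Ψ y θ' ∂ν) ∂ϑ

/-- A directional derivative depending on a parameter is a.e.-measurable in the parameter. -/
theorem aemeasurable_fderiv_apply {Θ E F : Type*} [MeasurableSpace Θ] {ϑ : Measure Θ}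
    [NormedAddCommGroup E] [NormedSpace ℝ E] [MeasurableSpace E]
    [NormedAddCommGroup F] [NormedSpace ℝ F] [SecondCountableTopology F]
    [MeasurableSpace F] [BorelSpace F]
    {Ψ : E → Θ → F} {DΨ : E → Θ → (E →L[ℝ] F)} {x : E}
    (hΨ : Measurable fun p : E × Θ => Ψ p.1 p.2)
    (hD : ∀ᵐ θ ∂ϑ, HasFDerivAt (fun x' => Ψ x' θ) (DΨ x θ) x) (v : E) :
    AEMeasurable (fun θ => DΨ x θ v) ϑ := by
  have hsec (z : E) : Measurable fun θ => Ψ z θ := hΨ.comp measurable_prodMk_left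
  refine aemeasurable_of_tendsto_metrizable_ae Filter.atTop
    (f := fun (n : ℕ) θ => (n : ℝ) • (Ψ (x + (n : ℝ)⁻¹ • v) θ - Ψ x θ)) (fun n => ?_) ?_
  · exact (((hsec _).sub (hsec _)).const_smul _).aemeasurable
  · filter_upwards [hD] with θ hθ
    refine hθ.lim v (c := fun n : ℕ => (n : ℝ)) ?_
    simpa using tendsto_natCast_atTop_atTop (R := ℝ)

/-- Applying the adjoint of a scalarly measurable family of operators preserves
a.e.-measurability. -/
theorem aestronglyMeasurable_adjoint_apply {Θ F : Type*} [MeasurableSpace Θ] {ϑ : Measure Θ}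
    {d : ℕ} [NormedAddCommGroup F] [InnerProductSpace ℝ F] [CompleteSpace F]
    [SecondCountableTopology F] [MeasurableSpace F] [BorelSpace F]
    {A : Θ → (EuclideanSpace ℝ (Fin d) →L[ℝ] F)} {w : Θ → F}
    (hA : ∀ v, AEMeasurable (fun θ => A θ v) ϑ) (hw : AEMeasurable w ϑ) :
    AEStronglyMeasurable (fun θ => ContinuousLinearMap.adjoint (A θ) (w θ)) ϑ := by
  have hcoord : AEMeasurable (fun θ (i : Fin d) =>
      (ContinuousLinearMap.adjoint (A θ) (w θ)) i) ϑ := by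
    refine aemeasurable_pi_lambda _ fun i => ?_
    have h : (fun θ => (ContinuousLinearMap.adjoint (A θ) (w θ)) i)
        = fun θ => inner ℝ (A θ (EuclideanSpace.single i 1)) (w θ) := by
      funext θ
      rw [← ContinuousLinearMap.adjoint_inner_right, EuclideanSpace.inner_single_left]
      simp
    rw [h]
    exact (hA _).inner hw
  exact ((WithLp.measurable_toLp 2 _).comp_aemeasurable hcoord).aestronglyMeasurable

/-- The square of the mean is at most the mean of the square. -/
theorem sq_integral_le_integral_sq {α : Type*} [MeasurableSpace α] {P : Measure α}
    [IsProbabilityMeasure P] {g : α → ℝ} (hg : MemLp g 2 P) :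
    (∫ a, g a ∂P) ^ 2 ≤ ∫ a, g a ^ 2 ∂P := by
  have h := ProbabilityTheory.variance_nonneg g P
  rw [ProbabilityTheory.variance_eq_sub hg] at h
  simpa using h

/-- The integrals of a bounded `c`-Lipschitz map against the two marginals of a coupling
differ by at most `c` times the `L²` transport cost of the coupling. -/
theorem norm_integral_fst_sub_integral_snd_le {E F : Type*}
    [NormedAddCommGroup E] [MeasurableSpace E] [BorelSpace E] [SecondCountableTopology E]
    [NormedAddCommGroup F] [NormedSpace ℝ F]
    {χ : Measure (E × E)} [IsProbabilityMeasure χ]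
    (hfst : Integrable (fun a => ‖a‖ ^ 2) χ.fst) (hsnd : Integrable (fun a => ‖a‖ ^ 2) χ.snd)
    {g : E → F} {c : ℝ} (hc : 0 ≤ c) (hg : Continuous g) (hgb : ∀ y, ‖g y‖ ≤ c)
    (hgl : ∀ a b, ‖g a - g b‖ ≤ c * ‖a - b‖) :
    ‖∫ y, g y ∂χ.fst - ∫ y, g y ∂χ.snd‖ ≤ c * Real.sqrt (∫ p, ‖p.1 - p.2‖ ^ 2 ∂χ) := by
  have hL1 : MemLp (fun p : E × E => p.1) 2 χ :=
    (memLp_two_iff_integrable_sq_norm measurable_fst.aestronglyMeasurable).2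
      (hfst.comp_measurable measurable_fst)
  have hL2 : MemLp (fun p : E × E => p.2) 2 χ :=
    (memLp_two_iff_integrable_sq_norm measurable_snd.aestronglyMeasurable).2
      (hsnd.comp_measurable measurable_snd)
  have hL : MemLp (fun p : E × E => ‖p.1 - p.2‖) 2 χ := (hL1.sub hL2).norm
  have hi1 : Integrable (fun p : E × E => g p.1) χ :=
    .of_bound (hg.comp continuous_fst).aestronglyMeasurable c (.of_forall fun p => hgb p.1)
  have hi2 : Integrable (fun p : E × E => g p.2) χ :=
    .of_bound (hg.comp continuous_snd).aestronglyMeasurable c (.of_forall fun p => hgb p.2)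
  rw [Measure.fst, Measure.snd,
    integral_map measurable_fst.aemeasurable hg.aestronglyMeasurable,
    integral_map measurable_snd.aemeasurable hg.aestronglyMeasurable, ← integral_sub hi1 hi2]
  calc ‖∫ p, (g p.1 - g p.2) ∂χ‖ ≤ ∫ p, c * ‖p.1 - p.2‖ ∂χ :=
        norm_integral_le_of_norm_le ((hL.integrable one_le_two).const_mul c)
          (.of_forall fun p => hgl p.1 p.2)
    _ = c * ∫ p, ‖p.1 - p.2‖ ∂χ := integral_const_mul _ _
    _ ≤ _ := mul_le_mul_of_nonneg_left
        (Real.le_sqrt_of_sq_le (sq_integral_le_integral_sq hL)) hc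

/-- If `‖h‖ ≤ g * s` with `g ∈ L²`, then centring `h` at most doubles the resulting
`L²` bound. -/
theorem sqrt_integral_norm_sub_integral_sq_le {Θ F : Type*} [MeasurableSpace Θ] {ϑ : Measure Θ}
    [IsProbabilityMeasure ϑ] [NormedAddCommGroup F] [NormedSpace ℝ F]
    {h : Θ → F} {g : Θ → ℝ} {s : ℝ} (hg : MemLp g 2 ϑ) (hs : 0 ≤ s)
    (hh : ∀ᵐ θ ∂ϑ, ‖h θ‖ ≤ g θ * s) :
    Real.sqrt (∫ θ, ‖h θ - ∫ θ', h θ' ∂ϑ‖ ^ 2 ∂ϑ)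
      ≤ 2 * Real.sqrt (∫ θ, g θ ^ 2 ∂ϑ) * s := by
  set K := ∫ θ, g θ ^ 2 ∂ϑ with hK
  set m := ∫ θ', h θ' ∂ϑ
  have hK0 : 0 ≤ K := integral_nonneg fun θ => sq_nonneg _
  have hm : ‖m‖ ^ 2 ≤ K * s ^ 2 := by
    have h1 : ‖m‖ ≤ (∫ θ, g θ ∂ϑ) * s := by
      rw [← integral_mul_const]
      exact norm_integral_le_of_norm_le ((hg.integrable one_le_two).mul_const s) hh
    calc ‖m‖ ^ 2 ≤ ((∫ θ, g θ ∂ϑ) * s) ^ 2 := pow_le_pow_left₀ (norm_nonneg _) h1 2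
      _ = (∫ θ, g θ ∂ϑ) ^ 2 * s ^ 2 := mul_pow _ _ _
      _ ≤ K * s ^ 2 := mul_le_mul_of_nonneg_right (sq_integral_le_integral_sq hg) (sq_nonneg s)
  have hint : Integrable (fun θ => 2 * s ^ 2 * g θ ^ 2) ϑ := hg.integrable_sq.const_mul _
  have hle : ∫ θ, ‖h θ - m‖ ^ 2 ∂ϑ ≤ ∫ θ, (2 * s ^ 2 * g θ ^ 2 + 2 * (K * s ^ 2)) ∂ϑ := by
    refine integral_mono_of_nonneg (.of_forall fun θ => sq_nonneg _)
      (hint.add (integrable_const _)) ?_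
    filter_upwards [hh] with θ hθ
    have h1 : ‖h θ - m‖ ^ 2 ≤ (‖h θ‖ + ‖m‖) ^ 2 :=
      pow_le_pow_left₀ (norm_nonneg _) (norm_sub_le _ _) 2
    have h2 : ‖h θ‖ ^ 2 ≤ (g θ * s) ^ 2 := pow_le_pow_left₀ (norm_nonneg _) hθ 2
    change ‖h θ - m‖ ^ 2 ≤ 2 * s ^ 2 * g θ ^ 2 + 2 * (K * s ^ 2)
    nlinarith [sq_nonneg (‖h θ‖ - ‖m‖)]
  rw [integral_add hint (integrable_const _), integral_const_mul, integral_const,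
    probReal_univ, one_smul, ← hK] at hle
  refine Real.sqrt_le_iff.2 ⟨by positivity, hle.trans (le_of_eq ?_)⟩
  rw [mul_pow, mul_pow, Real.sq_sqrt hK0]
  ring

/-- Quantitative `L²(ϑ)`-Lipschitz continuity of the fluctuation field `G`
in the measure variable, along any coupling `χ` of `μ` and `ν`:
`(∫ |G(μ,x,θ) − G(ν,x,θ)|² ϑ(dθ))^{1/2} ≤ 2 (∫ C(θ)⁴ ϑ(dθ))^{1/2} (∫ |a−b|² χ(da,db))^{1/2}`. -/
theorem fluctuation_field_L2_lipschitz
    {Θ : Type*} [MeasurableSpace Θ] (ϑ : Measure Θ) [IsProbabilityMeasure ϑ]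
    (d k₀ : ℕ) (hd : 0 < d) (hk₀ : 0 < k₀)
    (f : Θ → EuclideanSpace ℝ (Fin k₀))
    (Ψ : EuclideanSpace ℝ (Fin d) → Θ → EuclideanSpace ℝ (Fin k₀))
    (DΨ : EuclideanSpace ℝ (Fin d) → Θ →
      (EuclideanSpace ℝ (Fin d) →L[ℝ] EuclideanSpace ℝ (Fin k₀)))
    (hf : Measurable f)
    (hΨ : Measurable fun p : EuclideanSpace ℝ (Fin d) × Θ => Ψ p.1 p.2)
    (hΨdiff : ∀ᵐ θ ∂ϑ,
      (∀ x, HasFDerivAt (fun x' => Ψ x' θ) (DΨ x θ) x) ∧ Continuous fun x => DΨ x θ)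
    (C : Θ → ℝ) (hCmeas : Measurable C) (hC0 : ∀ θ, 0 ≤ C θ)
    (hC4 : Integrable (fun θ => C θ ^ 4) ϑ)
    (hbound : ∀ᵐ θ ∂ϑ, ∀ x, ‖Ψ x θ‖ + ‖DΨ x θ‖ ≤ C θ)
    (hf2 : Integrable (fun θ => ‖f θ‖ ^ 2) ϑ) :
    ∀ (μ ν : Measure (EuclideanSpace ℝ (Fin d))),
      IsProbabilityMeasure μ → IsProbabilityMeasure ν →
      Integrable (fun a => ‖a‖ ^ 2) μ → Integrable (fun a => ‖a‖ ^ 2) ν →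
      ∀ x : EuclideanSpace ℝ (Fin d),
      ∀ χ : Measure (EuclideanSpace ℝ (Fin d) × EuclideanSpace ℝ (Fin d)),
        IsProbabilityMeasure χ → χ.fst = μ → χ.snd = ν →
        Real.sqrt (∫ θ, ‖Gfield ϑ f Ψ DΨ μ x θ - Gfield ϑ f Ψ DΨ ν x θ‖ ^ 2 ∂ϑ)
          ≤ 2 * Real.sqrt (∫ θ, C θ ^ 4 ∂ϑ) * Real.sqrt (∫ p, ‖p.1 - p.2‖ ^ 2 ∂χ) := by
  intro μ ν hμ hν hμ2 hν2 x χ hχ hfst hsnd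
  subst hfst hsnd
  set s := Real.sqrt (∫ p, ‖p.1 - p.2‖ ^ 2 ∂χ)
  have hD := aemeasurable_fderiv_apply (x := x) hΨ (hΨdiff.mono fun θ hθ => hθ.1 x)
  have hC2 : MemLp (fun θ => C θ ^ 2) 2 ϑ := by
    refine (memLp_two_iff_integrable_sq (hCmeas.pow_const 2).aestronglyMeasurable).2 ?_
    simpa only [← pow_mul] using hC4
  have hCL : MemLp C 2 ϑ :=
    (memLp_two_iff_integrable_sq hCmeas.aestronglyMeasurable).2 (hC2.integrable one_le_two)
  have hfL : MemLp f 2 ϑ :=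
    (memLp_two_iff_integrable_sq_norm hf.aestronglyMeasurable).2 hf2
  have hadj : ∀ᵐ θ ∂ϑ, ∀ w, ‖ContinuousLinearMap.adjoint (DΨ x θ) w‖ ≤ C θ * ‖w‖ := by
    filter_upwards [hbound] with θ hθ w
    refine ContinuousLinearMap.le_of_opNorm_le _ ?_ w
    rw [LinearIsometryEquiv.norm_map]
    linarith [hθ x, norm_nonneg (Ψ x θ)]
  have hint (ρ : Measure (EuclideanSpace ℝ (Fin d))) [IsProbabilityMeasure ρ] :
      Integrable (fun θ => ContinuousLinearMap.adjoint (DΨ x θ) (f θ - ∫ y, Ψ y θ ∂ρ)) ϑ := by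
    have hmean : Measurable fun θ => ∫ y, Ψ y θ ∂ρ :=
      (hΨ.stronglyMeasurable.integral_prod_left' (μ := ρ)).measurable
    refine Integrable.mono' (g := fun θ => C θ * (‖f θ‖ + C θ))
      (hCL.integrable_mul (hfL.norm.add hCL))
      (aestronglyMeasurable_adjoint_apply hD (hf.sub hmean).aemeasurable) ?_
    filter_upwards [hadj, hbound] with θ hθ hb
    have hmle : ‖∫ y, Ψ y θ ∂ρ‖ ≤ C θ := by
      simpa using norm_integral_le_of_norm_le_const (μ := ρ)
        (.of_forall fun y => (by linarith [hb y, norm_nonneg (DΨ y θ)] : ‖Ψ y θ‖ ≤ C θ))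
    exact (hθ _).trans (mul_le_mul_of_nonneg_left
      ((norm_sub_le _ _).trans (by linarith)) (hC0 θ))
  set h : Θ → EuclideanSpace ℝ (Fin d) := fun θ =>
    ContinuousLinearMap.adjoint (DΨ x θ) (f θ - ∫ y, Ψ y θ ∂χ.fst)
      - ContinuousLinearMap.adjoint (DΨ x θ) (f θ - ∫ y, Ψ y θ ∂χ.snd) with hh
  have hG (θ : Θ) : Gfield ϑ f Ψ DΨ χ.fst x θ - Gfield ϑ f Ψ DΨ χ.snd x θ
      = h θ - ∫ θ', h θ' ∂ϑ := by
    rw [hh, integral_sub (hint χ.fst) (hint χ.snd), Gfield, Gfield]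
    exact sub_sub_sub_comm _ _ _ _
  have hle : ∀ᵐ θ ∂ϑ, ‖h θ‖ ≤ C θ ^ 2 * s := by
    filter_upwards [hadj, hbound, hΨdiff] with θ hθ hb hdiff
    have hbΨ (y) : ‖Ψ y θ‖ ≤ C θ := by linarith [hb y, norm_nonneg (DΨ y θ)]
    have hbD (y) : ‖DΨ y θ‖ ≤ C θ := by linarith [hb y, norm_nonneg (Ψ y θ)]
    have hcost := norm_integral_fst_sub_integral_snd_le hμ2 hν2 (g := fun y => Ψ y θ) (hC0 θ)
      (continuous_iff_continuousAt.2 fun y => (hdiff.1 y).continuousAt) hbΨ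
      fun a b => convex_univ.norm_image_sub_le_of_norm_hasFDerivWithin_le
        (fun y _ => (hdiff.1 y).hasFDerivWithinAt) (fun y _ => hbD y)
        (Set.mem_univ b) (Set.mem_univ a)
    rw [hh]
    simp only [← map_sub, sub_sub_sub_cancel_left]
    refine (hθ _).trans ?_
    rw [norm_sub_rev, sq, mul_assoc]
    exact mul_le_mul_of_nonneg_left hcost (hC0 θ)
  simp_rw [hG]
  have key := sqrt_integral_norm_sub_integral_sq_le hC2 (Real.sqrt_nonneg _) hle
  simpa only [← pow_mul] using key
end

section
/- The lifted cylindrical functional 𝐟 : L²(Ω,ℙ;ℝ^d) → ℝ defined by 𝐟(X) = h( 𝔼[φ₁(X)], …, 𝔼[φ_n(X)] ) is Fréchet differentiable at every X ∈ L²(Ω,ℙ;ℝ^d), and its Fréchet derivative is given by D𝐟(X)(k) = Σ_{i=1}^n ∂_i h( 𝔼[φ₁(X)], …, 𝔼[φ_n(X)] ) · 𝔼[ ∇φ_i(X) · k ] for k ∈ L²(Ω,ℙ;ℝ^d). -/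
open MeasureTheory
open scoped RealInnerProductSpace BigOperators

/-- First-order Taylor estimate for a function whose gradient is Lipschitz. -/
theorem LipschitzWith.norm_sub_sub_inner_gradient_le
    {E : Type*} [NormedAddCommGroup E] [InnerProductSpace ℝ E] [CompleteSpace E]
    {f : E → ℝ} {K : NNReal} (hf : Differentiable ℝ f) (hlip : LipschitzWith K (gradient f))
    (x y : E) : ‖f y - f x - ⟪gradient f x, y - x⟫‖ ≤ K * ‖y - x‖ ^ 2 := by
  have key := (convex_segment x y).norm_image_sub_le_of_norm_hasFDerivWithin_le' (𝕜 := ℝ)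
    (f := f) (f' := fun z => InnerProductSpace.toDual ℝ E (gradient f z))
    (φ := InnerProductSpace.toDual ℝ E (gradient f x)) (C := K * ‖y - x‖)
    (fun z _ => (hf z).hasGradientAt.hasFDerivAt.hasFDerivWithinAt)
    (fun z hz => by
      rw [← map_sub, LinearIsometryEquiv.norm_map]
      refine (hlip.norm_sub_le z x).trans ?_
      gcongr
      exact norm_sub_le_of_mem_segment hz)
    (left_mem_segment ℝ x y) (right_mem_segment ℝ x y)
  rw [InnerProductSpace.toDual_apply_apply] at key
  exact key.trans_eq (by ring)

theorem MeasureTheory.L2.integral_norm_sq {α E : Type*} [MeasurableSpace α]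
    [NormedAddCommGroup E] [InnerProductSpace ℝ E] {μ : Measure α} (X : Lp E 2 μ) :
    ∫ a, ‖X a‖ ^ 2 ∂μ = ‖X‖ ^ 2 := by
  rw [← real_inner_self_eq_norm_sq, L2.inner_def]
  simp only [real_inner_self_eq_norm_sq]

/-- The functional `X ↦ 𝔼[f(X)]` on `L²` is Fréchet differentiable, with gradient `∇f(X)`, when
`f` is bounded and `∇f` is bounded and Lipschitz. -/
theorem MeasureTheory.L2.hasFDerivAt_integral_comp
    {α E : Type*} [MeasurableSpace α] [NormedAddCommGroup E] [InnerProductSpace ℝ E]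
    [CompleteSpace E] {μ : Measure α} [IsFiniteMeasure μ] {f : E → ℝ} {B C K : NNReal}
    (hf : Differentiable ℝ f) (hbdd : ∀ x, |f x| ≤ B) (hgrad : ∀ x, ‖gradient f x‖ ≤ C)
    (hlip : LipschitzWith K (gradient f)) (X : Lp E 2 μ) :
    ∃ L : Lp E 2 μ →L[ℝ] ℝ,
      HasFDerivAt (fun Y : Lp E 2 μ => ∫ a, f (Y a) ∂μ) L X ∧
        ∀ k : Lp E 2 μ, L k = ∫ a, ⟪gradient f (X a), k a⟫ ∂μ := by
  have hG : MemLp (fun a => gradient f (X a)) 2 μ :=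
    MemLp.of_bound (hlip.continuous.comp_aestronglyMeasurable (Lp.aestronglyMeasurable X)) C
      (.of_forall fun a => hgrad _)
  have hint (Y : Lp E 2 μ) : Integrable (fun a => f (Y a)) μ :=
    .of_bound (hf.continuous.comp_aestronglyMeasurable (Lp.aestronglyMeasurable Y)) B
      (.of_forall fun a => hbdd _)
  refine ⟨innerSL ℝ hG.toLp, ?_, fun k => ?_⟩
  · rw [hasFDerivAt_iff_isLittleO]
    refine (Asymptotics.IsBigO.of_bound K (.of_forall fun Y => ?_)).trans_isLittleO
      (Asymptotics.isLittleO_pow_sub_sub X one_lt_two)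
    have hinner := L2.integrable_inner (𝕜 := ℝ) hG.toLp (Y - X)
    rw [innerSL_apply_apply, L2.inner_def, ← integral_sub (hint Y) (hint X),
      ← integral_sub (by exact (hint Y).sub (hint X)) hinner, norm_pow, norm_norm,
      ← L2.integral_norm_sq, ← integral_const_mul]
    refine norm_integral_le_of_norm_le
      (((Lp.memLp (Y - X)).integrable_norm_pow two_ne_zero).const_mul _) ?_
    filter_upwards [hG.coeFn_toLp, Lp.coeFn_sub Y X] with a ha hsub
    rw [ha, hsub]
    exact hlip.norm_sub_sub_inner_gradient_le hf (X a) (Y a)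
  · rw [innerSL_apply_apply, L2.inner_def]
    refine integral_congr_ae ?_
    filter_upwards [hG.coeFn_toLp] with a ha
    rw [ha]

/-- The lifted cylindrical functional `𝐟(X) = h(𝔼[φ₁(X)],…,𝔼[φ_n(X)])` on
`L²(Ω,ℙ;ℝ^d)` is Fréchet differentiable at every `X`, with derivative
`D𝐟(X)(k) = Σᵢ ∂ᵢh(𝔼[φ₁(X)],…,𝔼[φ_n(X)]) · 𝔼[∇φᵢ(X)·k]`. -/
theorem cylindrical_functional_frechet_derivative
    {Ω : Type*} [MeasurableSpace Ω] (ℙ : Measure Ω) [IsProbabilityMeasure ℙ]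
    (d n : ℕ) (hd : 0 < d) (hn : 0 < n)
    (φ : Fin n → EuclideanSpace ℝ (Fin d) → ℝ)
    (hφ : ∀ i, ContDiff ℝ 1 (φ i))
    (B : NNReal)
    (hφbdd : ∀ i x, |φ i x| ≤ B)
    (hgradbdd : ∀ i x, ‖gradient (φ i) x‖ ≤ B)
    (hgradlip : ∀ i, LipschitzWith B (gradient (φ i)))
    (h : (Fin n → ℝ) → ℝ) (hh : ContDiff ℝ 1 h) :
    ∀ X : Lp (EuclideanSpace ℝ (Fin d)) 2 ℙ,
      ∃ L : Lp (EuclideanSpace ℝ (Fin d)) 2 ℙ →L[ℝ] ℝ,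
        HasFDerivAt (fun Y : Lp (EuclideanSpace ℝ (Fin d)) 2 ℙ =>
            h fun i => ∫ ω, φ i (Y ω) ∂ℙ) L X
        ∧ ∀ k : Lp (EuclideanSpace ℝ (Fin d)) 2 ℙ,
            L k = ∑ i, fderiv ℝ h (fun j => ∫ ω, φ j (X ω) ∂ℙ) (Pi.single i 1)
                * ∫ ω, ⟪gradient (φ i) (X ω), k ω⟫ ∂ℙ := by
  intro X
  choose L hL hLk using fun i => L2.hasFDerivAt_integral_comp
    ((hφ i).differentiable one_ne_zero) (hφbdd i) (hgradbdd i) (hgradlip i) X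
  refine ⟨_, ((hh.differentiable one_ne_zero _).hasFDerivAt).comp X (hasFDerivAt_pi.2 hL),
    fun k => ?_⟩
  rw [ContinuousLinearMap.comp_apply, ← ContinuousLinearMap.coe_coe (fderiv ℝ h _),
    LinearMap.pi_apply_eq_sum_univ]
  refine Finset.sum_congr rfl fun i _ => ?_
  rw [ContinuousLinearMap.pi_apply, hLk, smul_eq_mul, mul_comm]
  congr 2
  ext j
  simp [Pi.single_apply, eq_comm]
end
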